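/- arXiv:1309.0028 — 2 statements merged into one kernel-verified Lean document; each statement's English description precedes it below -/
import Mathlib

section
/- For every positive integer k, the normalizer of Λ_{k,0} in the oscillator group G equals {(t,x,y,z) ∈ ℝ⁴ : t ∈ (π/2)ℤ, x ∈ (1/(2k))ℤ, y ∈ (1/(2k))ℤ, z ∈ ℝ}. -/
noncomputable section

/-- Points of `ℝ⁴`, written `(t, v, z)` with `t z : ℝ`, `v : ℝ × ℝ`. -/
abbrev P : Type := ℝ × (ℝ × ℝ) × ℝ

/-- The rotation `R(t)` acting on `ℝ²`. -/
def Rot (t : ℝ) (v : ℝ × ℝ) : ℝ × ℝ :=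
  (Real.cos t * v.1 - Real.sin t * v.2, Real.sin t * v.1 + Real.cos t * v.2)

/-- `vᵀ J w` for `J = [[0,1],[-1,0]]`. -/
def omegaJ (v w : ℝ × ℝ) : ℝ := v.1 * w.2 - v.2 * w.1

/-- The Lorentzian metric `g` at the point `p = (t,(x,y),z)`, with matrix
`[[0, y/2, −x/2, 1],[y/2, 1, 0, 0],[−x/2, 0, 1, 0],[1, 0, 0, 0]]`. -/
def gmet (p u w : P) : ℝ :=
  u.2.1.1 * w.2.1.1 + u.2.1.2 * w.2.1.2 + (u.1 * w.2.2 + u.2.2 * w.1)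
    + (p.2.1.2 / 2) * (u.1 * w.2.1.1 + u.2.1.1 * w.1)
    - (p.2.1.1 / 2) * (u.1 * w.2.1.2 + u.2.1.2 * w.1)

/-- `φ` is an isometry of `g`: a differentiable bijection whose differential
preserves `g` at every point. -/
def IsIsometry (φ : P → P) : Prop :=
  Differentiable ℝ φ ∧ Function.Bijective φ ∧
    ∀ p u w : P, gmet (φ p) (fderiv ℝ φ p u) (fderiv ℝ φ p w) = gmet p u w

/-- Multiplication of the oscillator group `G`. -/
def mulG (a b : P) : P :=
  (a.1 + b.1, a.2.1 + Rot a.1 b.2.1,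
   a.2.2 + b.2.2 + (1 / 2) * omegaJ a.2.1 (Rot a.1 b.2.1))

/-- Multiplication of the nilpotent group `N = ℝ × H₃(ℝ)`. -/
def mulN (a b : P) : P :=
  (a.1 + b.1, a.2.1 + b.2.1, a.2.2 + b.2.2 + (1 / 2) * omegaJ a.2.1 b.2.1)

/-- Inversion in the oscillator group `G`. -/
def invG (a : P) : P := (-a.1, -Rot (-a.1) a.2.1, -a.2.2)

/-- Multiplication of the Heisenberg group `H₃(ℝ)` on `ℝ² × ℝ`. -/
def mulH (a b : (ℝ × ℝ) × ℝ) : (ℝ × ℝ) × ℝ :=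
  (a.1 + b.1, a.2 + b.2 + (1 / 2) * omegaJ a.1 b.1)

/-- The map `φ_{(v',z')}(t,v,z) = (t, v − R(t)v', z − z' − ½ vᵀ J R(t) v')`. -/
def phiH (h : (ℝ × ℝ) × ℝ) (p : P) : P :=
  (p.1, p.2.1 - Rot p.1 h.1, p.2.2 - h.2 - (1 / 2) * omegaJ p.2.1 (Rot p.1 h.1))

/-- The one-parameter subgroups (geodesics through the identity) of `G`. -/
def alphaG (X : P) (s : ℝ) : P :=
  if X.1 = 0 then (0, (X.2.1.1 * s, X.2.1.2 * s), X.2.2 * s)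
  else
    (X.1 * s,
     ((X.2.1.1 / X.1) * Real.sin (X.1 * s) + (X.2.1.2 / X.1) * Real.cos (X.1 * s)
        - X.2.1.2 / X.1,
      -(X.2.1.1 / X.1) * Real.cos (X.1 * s) + (X.2.1.2 / X.1) * Real.sin (X.1 * s)
        + X.2.1.1 / X.1),
     (1 / 2) * (((X.2.1.1 ^ 2 + X.2.1.2 ^ 2) / X.1 + 2 * X.2.2) * s
        - ((X.2.1.1 ^ 2 + X.2.1.2 ^ 2) / X.1 ^ 2) * Real.sin (X.1 * s)))

/-- The lattice `θℤ × ℤ × ℤ × (1/(2k))ℤ` of `G`. -/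
def Lam (θ : ℝ) (k : ℕ) : Set P :=
  {p | (∃ m : ℤ, p.1 = θ * m) ∧ (∃ m : ℤ, p.2.1.1 = m) ∧ (∃ m : ℤ, p.2.1.2 = m)
     ∧ ∃ m : ℤ, p.2.2 = m / (2 * k)}

/-- `Λ` is a subgroup of the oscillator group `G`. -/
def IsSubgroupG (Λ : Set P) : Prop :=
  ((0, (0, 0), 0) : P) ∈ Λ ∧ (∀ a ∈ Λ, ∀ b ∈ Λ, mulG a b ∈ Λ) ∧ ∀ a ∈ Λ, invG a ∈ Λ

/-- Conjugation `g x g⁻¹` in `G`. -/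
def conjG (g x : P) : P := mulG (mulG g x) (invG g)

/-- The entries of the rotation by `t` are integers exactly when `t ∈ (π/2)ℤ`. -/
theorem exists_eq_pi_div_two_mul_iff (t : ℝ) :
    (∃ m : ℤ, t = (Real.pi / 2) * m) ↔
      ∃ a b : ℤ, Real.cos t = a ∧ Real.sin t = b := by
  have key : (∃ m : ℤ, t = (Real.pi / 2) * m) ↔ Real.sin t * Real.cos t = 0 := by
    have h2 : Real.sin t * Real.cos t = 0 ↔ Real.sin (2 * t) = 0 := by
      rw [Real.sin_two_mul, mul_assoc]
      simp
    rw [h2, Real.sin_eq_zero_iff]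
    refine exists_congr fun m => ⟨fun h => ?_, fun h => ?_⟩
    · rw [h]; ring
    · linear_combination -h / 2
  rw [key]
  have hsq := Real.sin_sq_add_cos_sq t
  constructor
  · intro h
    rcases mul_eq_zero.mp h with h | h
    · have hc : Real.cos t = 1 ∨ Real.cos t = -1 := by
        rw [← sq_eq_one_iff]; rw [h] at hsq; linarith
      rcases hc with hc | hc
      · exact ⟨1, 0, by simp [hc], by simp [h]⟩
      · exact ⟨-1, 0, by simp [hc], by simp [h]⟩
    · have hs : Real.sin t = 1 ∨ Real.sin t = -1 := by
        rw [← sq_eq_one_iff]; rw [h] at hsq; linarith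
      rcases hs with hs | hs
      · exact ⟨0, 1, by simp [h], by simp [hs]⟩
      · exact ⟨0, -1, by simp [h], by simp [hs]⟩
  · rintro ⟨a, b, ha, hb⟩
    rw [ha, hb] at hsq ⊢
    norm_cast at hsq ⊢
    by_contra hne
    have ha0 : a ≠ 0 := right_ne_zero_of_mul hne
    have hb0 : b ≠ 0 := left_ne_zero_of_mul hne
    have ha1 : 0 < a ^ 2 := by positivity
    have hb1 : 0 < b ^ 2 := by positivity
    omega

/-- Conjugation of an element whose first coordinate lies in `2πℤ`. -/
theorem conjG_two_pi_mul (g : P) (m : ℤ) (w : ℝ × ℝ) (c : ℝ) :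
    conjG g (2 * Real.pi * m, w, c) =
      (2 * Real.pi * m, Rot g.1 w, c + omegaJ g.2.1 (Rot g.1 w)) := by
  obtain ⟨t, ⟨x, y⟩, z⟩ := g
  obtain ⟨a, b⟩ := w
  have hc : Real.cos (t + 2 * Real.pi * m) = Real.cos t := by
    rw [show t + 2 * Real.pi * m = t + m * (2 * Real.pi) by ring]
    exact Real.cos_add_int_mul_two_pi t m
  have hs : Real.sin (t + 2 * Real.pi * m) = Real.sin t := by
    rw [show t + 2 * Real.pi * m = t + m * (2 * Real.pi) by ring]
    exact Real.sin_add_int_mul_two_pi t m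
  have hsq := Real.sin_sq_add_cos_sq t
  simp only [conjG, mulG, invG, Rot, omegaJ, hc, hs, Real.cos_neg, Real.sin_neg, Prod.mk_add_mk,
    Prod.neg_mk, Prod.mk.injEq]
  refine ⟨by ring, ⟨?_, ?_⟩, ?_⟩
  · linear_combination (-x) * hsq
  · linear_combination (-y) * hsq
  · linear_combination (1 / 2 * (x * (Real.sin t * a + Real.cos t * b)
      - y * (Real.cos t * a - Real.sin t * b))) * hsq

/-- Rotating back and then forth is the identity. -/
theorem Rot_Rot_neg (t : ℝ) (w : ℝ × ℝ) : Rot t (Rot (-t) w) = w := by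
  have hsq := Real.sin_sq_add_cos_sq t
  ext
  · simp only [Rot, Real.cos_neg, Real.sin_neg]
    linear_combination w.1 * hsq
  · simp only [Rot, Real.cos_neg, Real.sin_neg]
    linear_combination w.2 * hsq

/-- the normalizer of `Λ_{k,0}` in `G` is
`(π/2)ℤ × (1/(2k))ℤ × (1/(2k))ℤ × ℝ`. -/
theorem normalizer_Lam_zero (k : ℕ) (hk : 0 < k) :
    {g : P | (fun x => conjG g x) '' Lam (2 * Real.pi) k = Lam (2 * Real.pi) k} =
      {p : P | (∃ m : ℤ, p.1 = (Real.pi / 2) * m) ∧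
        (∃ m : ℤ, p.2.1.1 = m / (2 * k)) ∧ (∃ m : ℤ, p.2.1.2 = m / (2 * k))} := by
  ext ⟨t, ⟨x, y⟩, z⟩
  simp only [Set.mem_ofPred_eq]
  rw [exists_eq_pi_div_two_mul_iff]
  have hsq := Real.sin_sq_add_cos_sq t
  constructor
  · intro h
    have mem : ∀ a b : ℤ, ((2 * Real.pi * (0 : ℤ), Rot t (a, b),
        0 + omegaJ (x, y) (Rot t (a, b))) : P) ∈ Lam (2 * Real.pi) k := by
      intro a b
      rw [← h]
      exact ⟨(2 * Real.pi * (0 : ℤ), (a, b), 0), ⟨⟨0, rfl⟩, ⟨a, rfl⟩, ⟨b, rfl⟩, 0, by simp⟩,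
        conjG_two_pi_mul _ _ _ _⟩
    obtain ⟨-, ⟨c, hc⟩, ⟨s, hs⟩, ⟨A, hA⟩⟩ := mem 1 0
    obtain ⟨-, -, -, ⟨B, hB⟩⟩ := mem 0 1
    simp only [Rot, omegaJ, Int.cast_one, Int.cast_zero, mul_one, mul_zero, sub_zero, add_zero,
      zero_sub, zero_add] at hc hs hA hB
    refine ⟨⟨c, s, hc, hs⟩, ⟨s * A + c * B, ?_⟩, ⟨s * B - c * A, ?_⟩⟩
    · push_cast
      rw [add_div, mul_div_assoc, mul_div_assoc, ← hA, ← hB, ← hc, ← hs]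
      linear_combination (-x) * hsq
    · push_cast
      rw [sub_div, mul_div_assoc, mul_div_assoc, ← hA, ← hB, ← hc, ← hs]
      linear_combination (-y) * hsq
  · rintro ⟨⟨c, s, hc, hs⟩, ⟨X, hX⟩, ⟨Y, hY⟩⟩
    apply Set.Subset.antisymm
    · rintro _ ⟨⟨_, ⟨_, _⟩, _⟩, ⟨⟨m, rfl⟩, ⟨a, rfl⟩, ⟨b, rfl⟩, ⟨n, rfl⟩⟩, rfl⟩
      simp only [conjG_two_pi_mul]
      refine ⟨⟨m, rfl⟩, ⟨c * a - s * b, ?_⟩, ⟨s * a + c * b, ?_⟩,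
        ⟨n + (X * (s * a + c * b) - Y * (c * a - s * b)), ?_⟩⟩
      · simp [Rot, hc, hs]
      · simp [Rot, hc, hs]
      · simp only [Rot, omegaJ, hc, hs, hX, hY]
        push_cast
        ring
    · rintro ⟨_, ⟨_, _⟩, _⟩ ⟨⟨m, rfl⟩, ⟨a, rfl⟩, ⟨b, rfl⟩, ⟨n, rfl⟩⟩
      refine ⟨(2 * Real.pi * m, Rot (-t) (a, b), n / (2 * k) - omegaJ (x, y) (a, b)),
        ⟨⟨m, rfl⟩, ⟨c * a + s * b, ?_⟩, ⟨c * b - s * a, ?_⟩, ⟨n - (X * b - Y * a), ?_⟩⟩, ?_⟩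
      · simp [Rot, hc, hs]
      · simp only [Rot, Real.cos_neg, Real.sin_neg, hc, hs]
        push_cast
        ring
      · simp only [omegaJ, hX, hY]
        push_cast
        ring
      · simp [conjG_two_pi_mul, Rot_Rot_neg]
end
end

section
/- For every positive integer k, the normalizer of Λ_{k,π} in the oscillator group G equals {(t,x,y,z) ∈ ℝ⁴ : t ∈ (π/2)ℤ, x ∈ (1/2)ℤ, y ∈ (1/2)ℤ, z ∈ ℝ}. -/
noncomputable section

theorem mulG_assoc (a b c : P) : mulG (mulG a b) c = mulG a (mulG b c) := by
  have h := Real.sin_sq_add_cos_sq a.1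
  refine Prod.ext ?_ (Prod.ext (Prod.ext ?_ ?_) ?_) <;>
    simp only [mulG, Rot, omegaJ, Prod.fst_add, Prod.snd_add, Real.cos_add, Real.sin_add]
  · ring
  · ring
  · ring
  · linear_combination (-(1 / 2) * (b.2.1.1 * (Real.sin b.1 * c.2.1.1 + Real.cos b.1 * c.2.1.2)
      - b.2.1.2 * (Real.cos b.1 * c.2.1.1 - Real.sin b.1 * c.2.1.2))) * -h

theorem mulG_invG (a : P) : mulG a (invG a) = (0, (0, 0), 0) := by
  have h := Real.sin_sq_add_cos_sq a.1
  refine Prod.ext ?_ (Prod.ext (Prod.ext ?_ ?_) ?_) <;>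
    simp only [mulG, invG, Rot, omegaJ, Prod.fst_add, Prod.snd_add, Prod.fst_neg, Prod.snd_neg,
      Real.cos_neg, Real.sin_neg]
  · ring
  · linear_combination -a.2.1.1 * h
  · linear_combination -a.2.1.2 * h
  · ring

theorem mulG_zero (a : P) : mulG a (0, (0, 0), 0) = a := by
  refine Prod.ext ?_ (Prod.ext (Prod.ext ?_ ?_) ?_) <;> simp [mulG, Rot, omegaJ]

theorem zero_mulG (a : P) : mulG (0, (0, 0), 0) a = a := by
  refine Prod.ext ?_ (Prod.ext (Prod.ext ?_ ?_) ?_) <;> simp [mulG, Rot, omegaJ]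

theorem conjG_conjG_invG (g x : P) : conjG g (conjG (invG g) x) = x := by
  have h : mulG (invG (invG g)) (invG g) = (0, (0, 0), 0) := by
    have h' : invG (invG g) = g := by
      calc invG (invG g) = mulG (mulG g (invG g)) (invG (invG g)) := by
            rw [mulG_invG, zero_mulG]
        _ = g := by rw [mulG_assoc, mulG_invG, mulG_zero]
    rw [h', mulG_invG]
  calc conjG g (conjG (invG g) x)
      = mulG (mulG g (invG g)) (mulG x (mulG (invG (invG g)) (invG g))) := by
        simp only [conjG, mulG_assoc]
    _ = x := by rw [h, mulG_invG, zero_mulG, mulG_zero]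

theorem conjG_pi_mul (g : P) (m : ℤ) (w : ℝ × ℝ) (c : ℝ) :
    conjG g (Real.pi * m, w, c) =
      (Real.pi * m, (1 - (-1 : ℝ) ^ m) • g.2.1 + Rot g.1 w,
        c + (1 + (-1 : ℝ) ^ m) / 2 * omegaJ g.2.1 (Rot g.1 w)) := by
  have hs : Real.sin (Real.pi * m) = 0 := by rw [mul_comm, Real.sin_int_mul_pi]
  have hc : Real.cos (Real.pi * m) = (-1 : ℝ) ^ m := by rw [mul_comm, Real.cos_int_mul_pi]
  have h := Real.sin_sq_add_cos_sq g.1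
  generalize (-1 : ℝ) ^ m = e at *
  refine Prod.ext ?_ (Prod.ext (Prod.ext ?_ ?_) ?_) <;>
    simp only [conjG, mulG, invG, Rot, omegaJ, Prod.fst_add, Prod.snd_add, Prod.fst_neg,
      Prod.snd_neg, Prod.smul_fst, Prod.smul_snd, smul_eq_mul, Real.cos_neg, Real.sin_neg,
      Real.cos_add, Real.sin_add, hs, hc]
  · ring
  · linear_combination -e * g.2.1.1 * h
  · linear_combination -e * g.2.1.2 * h
  · linear_combination ((e / 2) * (g.2.1.1 * (Real.sin g.1 * w.1 + Real.cos g.1 * w.2)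
      - g.2.1.2 * (Real.cos g.1 * w.1 - Real.sin g.1 * w.2))) * h

theorem exists_int_cos_sin_pi_div_two_mul (m : ℤ) :
    ∃ a b : ℤ, Real.cos (Real.pi / 2 * m) = a ∧ Real.sin (Real.pi / 2 * m) = b := by
  have h_sign (j : ℤ) : ∃ a : ℤ, (-1 : ℝ) ^ j = a := by
    rcases Int.even_or_odd j with h | h
    · exact ⟨1, by simp [h.neg_one_zpow]⟩
    · exact ⟨-1, by simp [h.neg_one_zpow]⟩
  rcases Int.even_or_odd' m with ⟨j, rfl | rfl⟩ <;> obtain ⟨a, ha⟩ := h_sign j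
  · rw [show Real.pi / 2 * ((2 * j : ℤ) : ℝ) = j * Real.pi by push_cast; ring]
    exact ⟨a, 0, by rw [Real.cos_int_mul_pi, ha], by simp [Real.sin_int_mul_pi]⟩
  · rw [show Real.pi / 2 * ((2 * j + 1 : ℤ) : ℝ) = j * Real.pi + Real.pi / 2 by push_cast; ring]
    exact ⟨0, a, by simp [Real.cos_add_pi_div_two, Real.sin_int_mul_pi],
      by rw [Real.sin_add_pi_div_two, Real.cos_int_mul_pi, ha]⟩

/-- The set `(π/2)ℤ × (1/2)ℤ × (1/2)ℤ × ℝ`. -/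
def halfLattice : Set P :=
  {p | (∃ m : ℤ, p.1 = (Real.pi / 2) * m) ∧
    (∃ m : ℤ, p.2.1.1 = m / 2) ∧ (∃ m : ℤ, p.2.1.2 = m / 2)}

theorem invG_mem_halfLattice {g : P} (hg : g ∈ halfLattice) : invG g ∈ halfLattice := by
  obtain ⟨⟨n, hn⟩, ⟨p, hp⟩, ⟨q, hq⟩⟩ := hg
  obtain ⟨a, b, ha, hb⟩ := exists_int_cos_sin_pi_div_two_mul n
  refine ⟨⟨-n, ?_⟩, ⟨-(a * p + b * q), ?_⟩, ⟨-(-b * p + a * q), ?_⟩⟩ <;>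
    simp only [invG, Rot, Prod.fst_neg, Prod.snd_neg, Real.cos_neg, Real.sin_neg, hn, ha, hb,
      hp, hq] <;> push_cast <;> ring

theorem conjG_mem_Lam {k : ℕ} (hk : 0 < k) {g x : P} (hg : g ∈ halfLattice)
    (hx : x ∈ Lam Real.pi k) : conjG g x ∈ Lam Real.pi k := by
  obtain ⟨⟨n, hn⟩, ⟨p, hp⟩, ⟨q, hq⟩⟩ := hg
  obtain ⟨s, ⟨w₁, w₂⟩, c⟩ := x
  obtain ⟨⟨m, rfl⟩, ⟨i, rfl⟩, ⟨j, rfl⟩, ⟨l, rfl⟩⟩ := hx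
  obtain ⟨a, b, ha, hb⟩ := exists_int_cos_sin_pi_div_two_mul n
  have hk' : (k : ℝ) ≠ 0 := by positivity
  rw [conjG_pi_mul]
  simp only [Rot, omegaJ, hn, ha, hb]
  rcases Int.even_or_odd m with he | he <;> rw [he.neg_one_zpow]
  · refine ⟨⟨m, rfl⟩, ⟨a * i - b * j, ?_⟩, ⟨b * i + a * j, ?_⟩,
      ⟨l + k * (p * (b * i + a * j) - q * (a * i - b * j)), ?_⟩⟩ <;>
      simp only [Prod.fst_add, Prod.snd_add, Prod.smul_fst, Prod.smul_snd, smul_eq_mul, hp, hq] <;>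
      push_cast <;> field_simp <;> ring
  · refine ⟨⟨m, rfl⟩, ⟨p + (a * i - b * j), ?_⟩, ⟨q + (b * i + a * j), ?_⟩, ⟨l, ?_⟩⟩ <;>
      simp only [Prod.fst_add, Prod.snd_add, Prod.smul_fst, Prod.smul_snd, smul_eq_mul, hp, hq] <;>
      push_cast <;> ring

theorem mem_halfLattice_of_conjG_mem {k : ℕ} {g : P}
    (h : ∀ x ∈ Lam Real.pi k, conjG g x ∈ Lam Real.pi k) : g ∈ halfLattice := by
  have h₁ := h (Real.pi * (0 : ℤ), (1, 0), 0)
    ⟨⟨0, rfl⟩, ⟨1, by simp⟩, ⟨0, by simp⟩, ⟨0, by simp⟩⟩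
  have h₂ := h (Real.pi * (1 : ℤ), (0, 0), 0)
    ⟨⟨1, rfl⟩, ⟨0, by simp⟩, ⟨0, by simp⟩, ⟨0, by simp⟩⟩
  rw [conjG_pi_mul] at h₁ h₂
  obtain ⟨-, ⟨a, ha⟩, ⟨b, hb⟩, -⟩ := h₁
  obtain ⟨-, ⟨p, hp⟩, ⟨q, hq⟩, -⟩ := h₂
  simp [Rot] at ha hb hp hq
  refine ⟨?_, ⟨p, by linarith⟩, ⟨q, by linarith⟩⟩
  have hab : b ^ 2 + a ^ 2 = 1 := by
    have := Real.sin_sq_add_cos_sq g.1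
    rw [ha, hb] at this
    exact_mod_cast this
  have hmul : a * b = 0 := by
    by_contra hne
    have ha0 : 0 < a ^ 2 := by have := left_ne_zero_of_mul hne; positivity
    have hb0 : 0 < b ^ 2 := by have := right_ne_zero_of_mul hne; positivity
    omega
  have hsin : Real.sin (2 * g.1) = 0 := by
    rw [Real.sin_two_mul, ha, hb]
    have : (a : ℝ) * b = 0 := by exact_mod_cast hmul
    linear_combination 2 * this
  obtain ⟨n, hn⟩ := Real.sin_eq_zero_iff.1 hsin
  exact ⟨n, by linarith⟩

/-- the normalizer of `Λ_{k,π}` in `G` is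
`(π/2)ℤ × (1/2)ℤ × (1/2)ℤ × ℝ`. -/
theorem normalizer_Lam_pi (k : ℕ) (hk : 0 < k) :
    {g : P | (fun x => conjG g x) '' Lam Real.pi k = Lam Real.pi k} =
      {p : P | (∃ m : ℤ, p.1 = (Real.pi / 2) * m) ∧
        (∃ m : ℤ, p.2.1.1 = m / 2) ∧ (∃ m : ℤ, p.2.1.2 = m / 2)} := by
  change _ = halfLattice
  ext g
  constructor
  · intro hg
    refine mem_halfLattice_of_conjG_mem (k := k) fun x hx => ?_
    rw [← hg.out]
    exact ⟨x, hx, rfl⟩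
  · intro hg
    refine Set.Subset.antisymm ?_ fun x hx => ?_
    · rintro _ ⟨x, hx, rfl⟩
      exact conjG_mem_Lam hk hg hx
    · exact ⟨conjG (invG g) x, conjG_mem_Lam hk (invG_mem_halfLattice hg) hx,
        conjG_conjG_invG g x⟩
end
end
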